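/- Let g be a finite-dimensional Lie algebra and δ : g → Λ²g a Lie cobracket making (g, [,], δ) an involutive Lie bialgebra. Then the operator D on Λg defined by D(a₁∧⋯∧aₙ) = Σ_k (−1)^{k−1} δ(a_k) ∧ a₁∧⋯∧â_k∧⋯∧aₙ + Σ_{i<j} (−1)^{i+j−1} [a_i,a_j] ∧ a₁∧⋯∧â_i∧⋯∧â_j∧⋯∧aₙ satisfies D² = 0. -/

import Mathlib

open TensorProduct ExteriorAlgebra

/-- The Lie bracket `L ⊗ L → L` as a linear map. -/
noncomputable def brTensor (k L : Type) [Field k] [LieRing L] [LieAlgebra k L] :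
    L ⊗[k] L →ₗ[k] L :=
  TensorProduct.lift
    (LinearMap.mk₂ k (fun x y => ⁅x, y⁆) add_lie smul_lie lie_add lie_smul)

/-- The map `L ⊗ L → Λ L`, `x ⊗ y ↦ ι x ∧ ι y`. -/
noncomputable def wedgeTensor (k L : Type) [Field k] [LieRing L] [LieAlgebra k L] :
    L ⊗[k] L →ₗ[k] ExteriorAlgebra k L :=
  TensorProduct.lift
    (LinearMap.mk₂ k (fun x y => ι k x * ι k y)
      (fun x x' y => by simp [map_add, add_mul])
      (fun c x y => by simp [map_smul, smul_mul_assoc])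
      (fun x y y' => by simp [map_add, mul_add])
      (fun c x y => by simp [map_smul, mul_smul_comm]))

/-- The adjoint action of `a` on `L ⊗ L`: `ad a ⊗ 1 + 1 ⊗ ad a`. -/
noncomputable def adT (k L : Type) [Field k] [LieRing L] [LieAlgebra k L]
    (a : L) : L ⊗[k] L →ₗ[k] L ⊗[k] L :=
  LinearMap.rTensor L (LieAlgebra.ad k L a) + LinearMap.lTensor L (LieAlgebra.ad k L a)

/-- `δ₃ = (assoc) ∘ (δ ⊗ id) ∘ δ : L → L ⊗ (L ⊗ L)`. -/
noncomputable def delta3 (k L : Type) [Field k] [LieRing L] [LieAlgebra k L]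
    (δ : L →ₗ[k] L ⊗[k] L) : L →ₗ[k] L ⊗[k] (L ⊗[k] L) :=
  (TensorProduct.assoc k L L L).toLinearMap ∘ₗ (LinearMap.rTensor L δ) ∘ₗ δ

/-- The cyclic permutation `x ⊗ (y ⊗ z) ↦ y ⊗ (z ⊗ x)` on `L ⊗ (L ⊗ L)`. -/
noncomputable def cyc3 (k L : Type) [Field k] [LieRing L] [LieAlgebra k L] :
    L ⊗[k] (L ⊗[k] L) →ₗ[k] L ⊗[k] (L ⊗[k] L) :=
  (TensorProduct.assoc k L L L).toLinearMap ∘ₗ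
    (TensorProduct.comm k L (L ⊗[k] L)).toLinearMap

section ExteriorAlgebra

variable {k L : Type} [Field k] [LieRing L] [LieAlgebra k L]

theorem ι_mul_ι_swap (x y : L) : ι k x * ι k y = -(ι k y * ι k x) :=
  eq_neg_of_add_eq_zero_left (ι_add_mul_swap x y)

theorem ι_mul_ι_swap_assoc (x y : L) (u : ExteriorAlgebra k L) :
    ι k x * (ι k y * u) = -(ι k y * (ι k x * u)) := by
  rw [← mul_assoc, ι_mul_ι_swap, neg_mul, mul_assoc]

@[simp]
theorem wedgeTensor_tmul (x y : L) : wedgeTensor k L (x ⊗ₜ y) = ι k x * ι k y := rfl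

theorem commute_wedgeTensor_ι (t : L ⊗[k] L) (a : L) : Commute (wedgeTensor k L t) (ι k a) := by
  induction t with
  | zero => simp
  | add s t hs ht => simpa using hs.add_left ht
  | tmul x y =>
    rw [commute_iff_eq, wedgeTensor_tmul, ι_mul_ι_swap_assoc a x, ι_mul_ι_swap a y, mul_neg,
      neg_neg, mul_assoc]

theorem commute_wedgeTensor (s t : L ⊗[k] L) :
    Commute (wedgeTensor k L s) (wedgeTensor k L t) := by
  induction t with
  | zero => simp
  | add t t' ht ht' => simpa using ht.add_right ht'
  | tmul x y => exact (commute_wedgeTensor_ι s x).mul_right (commute_wedgeTensor_ι s y)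

/-- A linear endomorphism of the exterior algebra that kills `1` and whose kernel is stable under
left multiplication by vectors vanishes. -/
theorem linearMap_eq_zero_of_ι_mul {f : ExteriorAlgebra k L →ₗ[k] ExteriorAlgebra k L}
    (h1 : f 1 = 0) (hι : ∀ b u, f u = 0 → f (ι k b * u) = 0) : f = 0 := by
  refine LinearMap.ext fun u => ?_
  induction u using CliffordAlgebra.left_induction with
  | algebraMap r => simp [Algebra.algebraMap_eq_smul_one, h1]
  | add x y hx hy => simp_all
  | ι_mul x m hx => exact hι m x hx

/-- A linear endomorphism of the exterior algebra vanishes if it vanishes on products of vectors. -/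
theorem linearMap_eq_zero_of_list_prod {f : ExteriorAlgebra k L →ₗ[k] ExteriorAlgebra k L}
    (h : ∀ l : List L, f (l.map (ι k)).prod = 0) : f = 0 := by
  have hspan (u : ExteriorAlgebra k L) :
      u ∈ Submodule.span k (Set.range fun l : List L => (l.map (ι k)).prod) := by
    induction u using CliffordAlgebra.left_induction with
    | algebraMap r =>
      rw [Algebra.algebraMap_eq_smul_one]
      exact Submodule.smul_mem _ _ (Submodule.subset_span ⟨[], rfl⟩)
    | add x y hx hy => exact Submodule.add_mem _ hx hy
    | ι_mul x m hx =>
      refine Submodule.span_induction (p := fun x _ => ι k m * x ∈ Submodule.span k _)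
        ?_ (by simp) ?_ ?_ hx
      · rintro _ ⟨l, rfl⟩
        exact Submodule.subset_span ⟨m :: l, by simp⟩
      · intro x y _ _ hx hy
        rw [mul_add]
        exact Submodule.add_mem _ hx hy
      · intro r x _ hx
        rw [mul_smul_comm]
        exact Submodule.smul_mem _ _ hx
  refine LinearMap.ext fun u => ?_
  exact Submodule.span_induction (p := fun x _ => f x = 0) (by rintro _ ⟨l, rfl⟩; exact h l)
    (map_zero f) (fun x y _ _ hx hy => by simp [hx, hy]) (fun r x _ hx => by simp [hx]) (hspan u)

/-- The triple wedge product `L ⊗ (L ⊗ L) → Λ L`. -/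
noncomputable def wedgeTensor₃ (k L : Type) [Field k] [LieRing L] [LieAlgebra k L] :
    L ⊗[k] (L ⊗[k] L) →ₗ[k] ExteriorAlgebra k L :=
  TensorProduct.lift ((LinearMap.mul k (ExteriorAlgebra k L)).compl₁₂ (ι k) (wedgeTensor k L))

@[simp]
theorem wedgeTensor₃_tmul (x : L) (t : L ⊗[k] L) :
    wedgeTensor₃ k L (x ⊗ₜ t) = ι k x * wedgeTensor k L t := rfl

theorem wedgeTensor₃_assoc_tmul (t : L ⊗[k] L) (z : L) :
    wedgeTensor₃ k L (TensorProduct.assoc k L L L (t ⊗ₜ z)) = wedgeTensor k L t * ι k z := by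
  induction t with
  | zero => simp
  | add s t hs ht => simp [add_tmul, hs, ht, add_mul]
  | tmul x y => simp [mul_assoc]

theorem wedgeTensor₃_cyc3 (t : L ⊗[k] (L ⊗[k] L)) :
    wedgeTensor₃ k L (cyc3 k L t) = wedgeTensor₃ k L t := by
  induction t with
  | zero => simp
  | add s t hs ht => simp [hs, ht]
  | tmul x s =>
    simp only [cyc3, LinearMap.comp_apply, LinearEquiv.coe_coe, TensorProduct.comm_tmul,
      wedgeTensor₃_assoc_tmul, wedgeTensor₃_tmul]
    exact commute_wedgeTensor_ι s x

/-- The derivation of `Λ L` induced by `ad a`, expanded along a list of vectors. -/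
theorem sum_lie_eraseIdx_cons (a b : L) (l : List L) :
    ∑ i : Fin (b :: l).length, (-1 : k) ^ (i : ℕ) •
        (ι k ⁅a, (b :: l).get i⁆ * (((b :: l).eraseIdx i).map (ι k)).prod)
      = ι k ⁅a, b⁆ * (l.map (ι k)).prod
        + ι k b * ∑ i : Fin l.length, (-1 : k) ^ (i : ℕ) •
            (ι k ⁅a, l.get i⁆ * ((l.eraseIdx i).map (ι k)).prod) := by
  simp only [List.length_cons, Fin.sum_univ_succ, Finset.mul_sum]
  congr 1
  · simp
  · refine Finset.sum_congr rfl fun i _ => ?_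
    simp [pow_succ, ι_mul_ι_swap_assoc b]

end ExteriorAlgebra

section Operator

variable {k L : Type} [Field k] [LieRing L] [LieAlgebra k L]
  {δ : L →ₗ[k] L ⊗[k] L} {D : ExteriorAlgebra k L →ₗ[k] ExteriorAlgebra k L}

/-- The anticommutator of `D` with left multiplication by `a`. -/
noncomputable def anticomm (D : ExteriorAlgebra k L →ₗ[k] ExteriorAlgebra k L) (a : L) :
    ExteriorAlgebra k L →ₗ[k] ExteriorAlgebra k L :=
  D ∘ₗ LinearMap.mulLeft k (ι k a) + LinearMap.mulLeft k (ι k a) ∘ₗ D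

theorem map_ι_mul (a : L) (u : ExteriorAlgebra k L) :
    D (ι k a * u) = anticomm D a u - ι k a * D u := by
  simp [anticomm]

theorem anticomm_list_prod
    (hD : ∀ l : List L, D (l.map (ι k)).prod
      = (∑ i : Fin l.length, (-1 : k) ^ (i : ℕ) •
          (wedgeTensor k L (δ (l.get i)) * ((l.eraseIdx i).map (ι k)).prod))
        + ∑ i : Fin l.length, ∑ j : Fin l.length,
            (if (i : ℕ) < (j : ℕ) then
              (-1 : k) ^ ((i : ℕ) + (j : ℕ) + 1) •
                (ι k ⁅l.get i, l.get j⁆ * (((l.eraseIdx j).eraseIdx i).map (ι k)).prod)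
            else 0))
    (a : L) (l : List L) :
    anticomm D a (l.map (ι k)).prod
      = wedgeTensor k L (δ a) * (l.map (ι k)).prod
        + ∑ i : Fin l.length, (-1 : k) ^ (i : ℕ) •
            (ι k ⁅a, l.get i⁆ * ((l.eraseIdx i).map (ι k)).prod) := by
  have hcons := hD (a :: l)
  simp only [List.length_cons, Fin.sum_univ_succ, List.map_cons, List.prod_cons] at hcons
  have hδ (i : Fin l.length) (u : ExteriorAlgebra k L) :
      wedgeTensor k L (δ (l.get i)) * (ι k a * u)
        = ι k a * (wedgeTensor k L (δ (l.get i)) * u) :=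
    (commute_wedgeTensor_ι _ a).left_comm u
  have hbr (i j : Fin l.length) (u : ExteriorAlgebra k L) :
      ι k ⁅l.get i, l.get j⁆ * (ι k a * u) = -(ι k a * (ι k ⁅l.get i, l.get j⁆ * u)) :=
    ι_mul_ι_swap_assoc _ _ _
  rw [anticomm, LinearMap.add_apply, LinearMap.comp_apply, LinearMap.comp_apply,
    LinearMap.mulLeft_apply, LinearMap.mulLeft_apply, hcons, hD l, mul_add, Finset.mul_sum,
    Finset.mul_sum]
  simp only [Finset.mul_sum, mul_ite, mul_zero]
  simp only [Fin.val_zero, Fin.val_succ, List.get_cons_zero, List.get_cons_succ',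
    List.eraseIdx_cons_zero, List.eraseIdx_cons_succ, List.map_cons, List.prod_cons, hδ, hbr]
  have hite (p : Prop) [Decidable p] (x : ExteriorAlgebra k L) :
      (if p then -x else 0) = -if p then x else 0 := by
    split_ifs <;> simp
  simp only [pow_succ, pow_add, pow_zero, mul_neg, mul_one, neg_mul, neg_neg, neg_smul,
    smul_neg, one_smul, mul_smul_comm, lt_self_iff_false, not_lt_zero, Nat.zero_lt_succ,
    add_lt_add_iff_right, if_true, if_false, zero_add, hite, Finset.sum_neg_distrib]
  abel

theorem anticomm_wedgeTensor
    (hone : ∀ a, anticomm D a 1 = wedgeTensor k L (δ a))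
    (hcomm : ∀ a b u, anticomm D a (ι k b * u) = ι k ⁅a, b⁆ * u + ι k b * anticomm D a u)
    (a : L) (t : L ⊗[k] L) :
    anticomm D a (wedgeTensor k L t)
      = wedgeTensor k L (adT k L a t) + wedgeTensor k L t * wedgeTensor k L (δ a) := by
  induction t with
  | zero => simp
  | add s t hs ht => simp only [map_add, hs, ht, add_mul]; abel
  | tmul x y =>
    have hy := hcomm a y 1
    rw [mul_one, mul_one, hone] at hy
    simp [adT, hcomm, hy, mul_add, mul_assoc, add_assoc]

theorem anticomm_lie
    (hone : ∀ a, anticomm D a 1 = wedgeTensor k L (δ a))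
    (hcomm : ∀ a b u, anticomm D a (ι k b * u) = ι k ⁅a, b⁆ * u + ι k b * anticomm D a u)
    (hcocycle : ∀ a b : L, δ ⁅a, b⁆ = adT k L a (δ b) - adT k L b (δ a)) (a b : L) :
    anticomm D ⁅a, b⁆ = anticomm D a ∘ₗ anticomm D b - anticomm D b ∘ₗ anticomm D a := by
  rw [← sub_eq_zero]
  refine linearMap_eq_zero_of_ι_mul ?_ fun c u hu => ?_
  · simp only [LinearMap.sub_apply, LinearMap.comp_apply, hone, anticomm_wedgeTensor hone hcomm,
      hcocycle, map_sub, (commute_wedgeTensor (δ b) (δ a)).eq]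
    abel
  · simp only [LinearMap.sub_apply, LinearMap.comp_apply, hcomm, map_add] at hu ⊢
    have hu' : ι k c * (anticomm D ⁅a, b⁆ u
        - (anticomm D a (anticomm D b u) - anticomm D b (anticomm D a u))) = 0 := by
      rw [hu, mul_zero]
    rw [← hu', lie_lie, map_sub, sub_mul, mul_sub, mul_sub]
    abel

theorem map_wedgeTensor (hD1 : D 1 = 0)
    (hone : ∀ a, anticomm D a 1 = wedgeTensor k L (δ a))
    (hcomm : ∀ a b u, anticomm D a (ι k b * u) = ι k ⁅a, b⁆ * u + ι k b * anticomm D a u)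
    (t : L ⊗[k] L) :
    D (wedgeTensor k L t)
      = ι k (brTensor k L t)
        + wedgeTensor₃ k L (TensorProduct.assoc k L L L (LinearMap.rTensor L δ t))
        - wedgeTensor₃ k L
            (TensorProduct.assoc k L L L (LinearMap.rTensor L δ (TensorProduct.comm k L L t))) := by
  induction t with
  | zero => simp
  | add s t hs ht => simp only [map_add, hs, ht]; abel
  | tmul x y =>
    have hy := hcomm x y 1
    have hDy : D (ι k y) = wedgeTensor k L (δ y) := by
      simpa [hD1, hone] using map_ι_mul (D := D) y 1
    rw [mul_one, mul_one, hone] at hy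
    rw [wedgeTensor_tmul, map_ι_mul, hy, hDy, LinearMap.rTensor_tmul, TensorProduct.comm_tmul,
      LinearMap.rTensor_tmul, wedgeTensor₃_assoc_tmul, wedgeTensor₃_assoc_tmul,
      (commute_wedgeTensor_ι (δ x) y).eq, (commute_wedgeTensor_ι (δ y) x).eq]
    rfl

theorem wedgeTensor₃_delta3_eq_zero [CharZero k]
    (hcojac : ∀ a : L,
      delta3 k L δ a + cyc3 k L (delta3 k L δ a)
        + cyc3 k L (cyc3 k L (delta3 k L δ a)) = 0) (a : L) :
    wedgeTensor₃ k L (delta3 k L δ a) = 0 := by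
  have h := congrArg (wedgeTensor₃ k L) (hcojac a)
  simp only [map_add, wedgeTensor₃_cyc3, map_zero] at h
  have h3 : (3 : k) • wedgeTensor₃ k L (delta3 k L δ a) = 0 := by
    rw [← h]
    module
  exact (smul_eq_zero.mp h3).resolve_left three_ne_zero

theorem comp_self_eq_zero_of_anticomm (hD1 : D 1 = 0)
    (hone : ∀ a, anticomm D a 1 = wedgeTensor k L (δ a))
    (hcomm : ∀ a b u, anticomm D a (ι k b * u) = ι k ⁅a, b⁆ * u + ι k b * anticomm D a u)
    (hcocycle : ∀ a b : L, δ ⁅a, b⁆ = adT k L a (δ b) - adT k L b (δ a))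
    (hDδ : ∀ a, D (wedgeTensor k L (δ a)) = 0) :
    D ∘ₗ D = 0 := by
  have hE (a : L) : D ∘ₗ anticomm D a - anticomm D a ∘ₗ D = 0 := by
    refine linearMap_eq_zero_of_ι_mul (by simp [hone, hDδ, hD1]) fun b u hu => ?_
    have hu' : ι k b * D (anticomm D a u) = ι k b * anticomm D a (D u) := by
      exact congrArg _ (sub_eq_zero.mp hu)
    have hlie := LinearMap.congr_fun (anticomm_lie hone hcomm hcocycle a b) u
    simp only [LinearMap.sub_apply, LinearMap.comp_apply, hcomm, map_add, map_sub, map_ι_mul,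
      hu', hlie]
    abel
  refine linearMap_eq_zero_of_ι_mul (by simp [hD1]) fun a u hu => ?_
  have h := LinearMap.congr_fun (hE a) u
  simp only [LinearMap.sub_apply, LinearMap.comp_apply, LinearMap.zero_apply] at h hu
  rw [LinearMap.comp_apply, map_ι_mul, map_sub, map_ι_mul, hu, mul_zero, sub_zero, h]

end Operator

/-- for a finite-dimensional involutive Lie bialgebra `(L, [,], δ)`
(char 0), the operator `D` on `Λ L` defined by
`D(a₁∧⋯∧aₙ) = Σ_k (−1)^{k−1} δ(a_k) ∧ a₁∧⋯∧â_k∧⋯∧aₙ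
  + Σ_{i<j} (−1)^{i+j−1} [a_i,a_j] ∧ a₁∧⋯∧â_i∧⋯∧â_j∧⋯∧aₙ`
satisfies `D² = 0`. -/
theorem stmt_9 {k L : Type} [Field k] [CharZero k] [LieRing L] [LieAlgebra k L]
    [FiniteDimensional k L]
    (δ : L →ₗ[k] L ⊗[k] L)
    (hskew : ∀ a : L, (TensorProduct.comm k L L) (δ a) = - δ a)
    (hcocycle : ∀ a b : L, δ ⁅a, b⁆ = adT k L a (δ b) - adT k L b (δ a))
    (hcojac : ∀ a : L,
      delta3 k L δ a + cyc3 k L (delta3 k L δ a)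
        + cyc3 k L (cyc3 k L (delta3 k L δ a)) = 0)
    (hinv : ∀ a : L, brTensor k L (δ a) = 0)
    (D : ExteriorAlgebra k L →ₗ[k] ExteriorAlgebra k L)
    (hD : ∀ (n : ℕ) (a : Fin n → L),
      D ((List.ofFn fun i => ι k (a i)).prod)
        = (∑ i : Fin n, ((-1 : k) ^ (i : ℕ)) •
            (wedgeTensor k L (δ (a i)) *
              (((List.ofFn a).eraseIdx (i : ℕ)).map (ι k)).prod))
          + ∑ i : Fin n, ∑ j : Fin n,
              (if (i : ℕ) < (j : ℕ) then
                ((-1 : k) ^ ((i : ℕ) + (j : ℕ) + 1)) •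
                  (ι k ⁅a i, a j⁆ *
                    ((((List.ofFn a).eraseIdx (j : ℕ)).eraseIdx (i : ℕ)).map
                      (ι k)).prod)
              else 0)) :
    D ∘ₗ D = 0 := by
  have hDl (l : List L) : D (l.map (ι k)).prod
      = (∑ i : Fin l.length, (-1 : k) ^ (i : ℕ) •
          (wedgeTensor k L (δ (l.get i)) * ((l.eraseIdx i).map (ι k)).prod))
        + ∑ i : Fin l.length, ∑ j : Fin l.length,
            (if (i : ℕ) < (j : ℕ) then
              (-1 : k) ^ ((i : ℕ) + (j : ℕ) + 1) •
                (ι k ⁅l.get i, l.get j⁆ * (((l.eraseIdx j).eraseIdx i).map (ι k)).prod)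
            else 0) := by
    have h := hD l.length l.get
    rw [List.ofFn_get] at h
    have hl := List.map_ofFn (f := l.get) (g := ι k)
    rw [List.ofFn_get] at hl
    rw [hl]
    exact h
  have hlist := anticomm_list_prod hDl
  have hone (a : L) : anticomm D a 1 = wedgeTensor k L (δ a) := by simpa using hlist a []
  have hcomm (a b : L) (u : ExteriorAlgebra k L) :
      anticomm D a (ι k b * u) = ι k ⁅a, b⁆ * u + ι k b * anticomm D a u := by
    have h : anticomm D a ∘ₗ LinearMap.mulLeft k (ι k b)
        - (LinearMap.mulLeft k (ι k ⁅a, b⁆) + LinearMap.mulLeft k (ι k b) ∘ₗ anticomm D a)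
          = 0 := by
      refine linearMap_eq_zero_of_list_prod fun l => ?_
      have hl := hlist a (b :: l)
      rw [sum_lie_eraseIdx_cons, List.map_cons, List.prod_cons,
        (commute_wedgeTensor_ι (δ a) b).left_comm] at hl
      simp only [LinearMap.sub_apply, LinearMap.add_apply, LinearMap.comp_apply,
        LinearMap.mulLeft_apply, hl, hlist, mul_add]
      abel
    exact sub_eq_zero.mp (LinearMap.congr_fun h u)
  have hD1 : D 1 = 0 := by simpa using hDl []
  refine comp_self_eq_zero_of_anticomm hD1 hone hcomm hcocycle fun a => ?_
  have h3 : wedgeTensor₃ k L (TensorProduct.assoc k L L L (LinearMap.rTensor L δ (δ a))) = 0 :=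
    wedgeTensor₃_delta3_eq_zero hcojac a
  rw [map_wedgeTensor hD1 hone hcomm, hinv, hskew, map_neg, map_neg, map_neg, h3]
  simp
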